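/- Let u : ℤ × ℤ → ℝ satisfy u_{i,j} ≠ 0 for all i, j and the discrete equation u_{i+1,j+1} − u_{i,j+1} + 1/u_{i+1,j} − 1/u_{i,j} = 0 for all i, j ∈ ℤ. Fix i, j ∈ ℤ and suppose that u_{i+3,j} ≠ u_{i+1,j}, u_{i+2,j} ≠ u_{i,j}, u_{i+3,j+1} ≠ u_{i+1,j+1}, and u_{i+2,j+1} ≠ u_{i,j+1}. Then (u_{i+3,j+1} − u_{i+2,j+1})(u_{i+1,j+1} − u_{i,j+1}) / ((u_{i+3,j+1} − u_{i+1,j+1})(u_{i+2,j+1} − u_{i,j+1})) = (u_{i+3,j} − u_{i+2,j})(u_{i+1,j} − u_{i,j}) / ((u_{i+3,j} − u_{i+1,j})(u_{i+2,j} − u_{i,j})). -/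

import Mathlib

/-- The cross-ratio of four nonzero elements of a field is invariant under inversion. -/
theorem crossRatio_inv {K : Type*} [Field K] {a b c d : K}
    (ha : a ≠ 0) (hb : b ≠ 0) (hc : c ≠ 0) (hd : d ≠ 0) :
    (c⁻¹ - d⁻¹) * (a⁻¹ - b⁻¹) / ((b⁻¹ - d⁻¹) * (a⁻¹ - c⁻¹)) =
      (d - c) * (b - a) / ((d - b) * (c - a)) := by
  rw [inv_sub_inv hc hd, inv_sub_inv ha hb, inv_sub_inv hb hd, inv_sub_inv ha hc,
    div_mul_div_comm, div_mul_div_comm, show b * d * (a * c) = c * d * (a * b) by ring]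
  exact div_div_div_cancel_right₀ (by simp [ha, hb, hc, hd]) _ _

/-- For the discrete equation `u_{i+1,j+1} - u_{i,j+1} + 1/u_{i+1,j} - 1/u_{ij} = 0`,
the cross-ratio `J` is a j-integral. -/
theorem discrete_eg3_j_integral
    (u : ℤ → ℤ → ℝ)
    (hne : ∀ (i j : ℤ), u i j ≠ 0)
    (heq : ∀ (i j : ℤ),
      u (i + 1) (j + 1) - u i (j + 1) + 1 / u (i + 1) j - 1 / u i j = 0)
    (i j : ℤ)
    (h1 : u (i + 3) j ≠ u (i + 1) j)
    (h2 : u (i + 2) j ≠ u i j)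
    (h3 : u (i + 3) (j + 1) ≠ u (i + 1) (j + 1))
    (h4 : u (i + 2) (j + 1) ≠ u i (j + 1)) :
    (u (i + 3) (j + 1) - u (i + 2) (j + 1)) * (u (i + 1) (j + 1) - u i (j + 1)) /
      ((u (i + 3) (j + 1) - u (i + 1) (j + 1)) * (u (i + 2) (j + 1) - u i (j + 1))) =
    (u (i + 3) j - u (i + 2) j) * (u (i + 1) j - u i j) /
      ((u (i + 3) j - u (i + 1) j) * (u (i + 2) j - u i j)) := by
  have e0 : u (i + 1) (j + 1) - u i (j + 1) = (u i j)⁻¹ - (u (i + 1) j)⁻¹ := by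
    linear_combination heq i j
  have e1 : u (i + 2) (j + 1) - u (i + 1) (j + 1) = (u (i + 1) j)⁻¹ - (u (i + 2) j)⁻¹ := by
    have h := heq (i + 1) j
    rw [add_assoc i 1 1, one_add_one_eq_two] at h
    linear_combination h
  have e2 : u (i + 3) (j + 1) - u (i + 2) (j + 1) = (u (i + 2) j)⁻¹ - (u (i + 3) j)⁻¹ := by
    have h := heq (i + 2) j
    rw [add_assoc i 2 1, two_add_one_eq_three] at h
    linear_combination h
  have e02 : u (i + 2) (j + 1) - u i (j + 1) = (u i j)⁻¹ - (u (i + 2) j)⁻¹ := by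
    linear_combination e0 + e1
  have e13 : u (i + 3) (j + 1) - u (i + 1) (j + 1) = (u (i + 1) j)⁻¹ - (u (i + 3) j)⁻¹ := by
    linear_combination e1 + e2
  rw [e0, e2, e02, e13]
  exact crossRatio_inv (hne i j) (hne (i + 1) j) (hne (i + 2) j) (hne (i + 3) j)
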